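/- Monotonicity of the tilted Gaussian tail power. Fix q ≥ 1, b̄ < 0, and ζ > −b̄. Then the function x ↦ Φ( −(b̄ + x ζ) / √(1 − x²) )^q is strictly increasing on [0, 1), where Φ is the standard Gaussian tail function. -/

import Mathlib

open MeasureTheory

/-- The standard Gaussian tail function `Φ(x) = ∫_x^∞ (2π)^{-1/2} e^{-u²/2} du`. -/
noncomputable def gaussTail (x : ℝ) : ℝ :=
  ∫ u in Set.Ioi x, Real.exp (-(u ^ 2) / 2) / Real.sqrt (2 * Real.pi)

lemma gaussDensity_integrable :
    Integrable (fun u : ℝ => Real.exp (-(u ^ 2) / 2) / Real.sqrt (2 * Real.pi)) := by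
  have h := (integrable_exp_neg_mul_sq (b := 1 / 2) (by norm_num)).div_const
    (Real.sqrt (2 * Real.pi))
  convert h using 4
  ring

lemma gaussTail_strictAnti : StrictAnti gaussTail := by
  intro x y hxy
  have hI := gaussDensity_integrable
  unfold gaussTail
  rw [← Set.Ioc_union_Ioi_eq_Ioi hxy.le,
    setIntegral_union (Set.Ioc_disjoint_Ioi le_rfl) measurableSet_Ioi hI.integrableOn
      hI.integrableOn]
  have : 0 < ∫ u in Set.Ioc x y, Real.exp (-(u ^ 2) / 2) / Real.sqrt (2 * Real.pi) := by
    rw [← intervalIntegral.integral_of_le hxy.le]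
    refine intervalIntegral.intervalIntegral_pos_of_pos hI.intervalIntegrable (fun u => ?_) hxy
    positivity
  linarith

lemma gaussTail_nonneg (x : ℝ) : 0 ≤ gaussTail x := by
  unfold gaussTail
  exact integral_nonneg fun u => by positivity

/-- Monotonicity of the tilted Gaussian tail power: for `q ≥ 1`, `b̄ < 0` and `ζ > -b̄`, the
function `x ↦ Φ(-(b̄ + xζ)/√(1-x²))^q` is strictly increasing on `[0,1)`. -/
theorem gaussTail_tilted_power_strictMono (q b ζ : ℝ) (hq : 1 ≤ q) (hb : b < 0)
    (hζ : -b < ζ) :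
    StrictMonoOn (fun x : ℝ => gaussTail (-(b + x * ζ) / Real.sqrt (1 - x ^ 2)) ^ q)
      (Set.Ico 0 1) := by
  intro x hx y hy hxy
  obtain ⟨hx0, hx1⟩ := hx
  obtain ⟨hy0, hy1⟩ := hy
  refine Real.rpow_lt_rpow (gaussTail_nonneg _) (gaussTail_strictAnti ?_) (by linarith)
  have hs2 : 0 < 1 - x ^ 2 := by nlinarith
  have ht2 : 0 < 1 - y ^ 2 := by nlinarith
  have hs := Real.sqrt_pos.2 hs2
  have ht := Real.sqrt_pos.2 ht2
  have hss := Real.sq_sqrt hs2.le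
  have htt := Real.sq_sqrt ht2.le
  have hts : Real.sqrt (1 - y ^ 2) < Real.sqrt (1 - x ^ 2) :=
    Real.sqrt_lt_sqrt ht2.le (by nlinarith)
  generalize Real.sqrt (1 - x ^ 2) = s at *
  generalize Real.sqrt (1 - y ^ 2) = t at *
  have key : s * (1 - y) ≤ t * (1 - x) := by
    refine (sq_le_sq₀ (mul_nonneg hs.le (by linarith)) (mul_nonneg ht.le (by linarith))).1 ?_
    rw [mul_pow, mul_pow, hss, htt]
    have h : 0 ≤ 2 * ((1 - x) * (1 - y)) * (y - x) :=
      mul_nonneg (mul_nonneg two_pos.le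
        (mul_nonneg (by linarith) (by linarith))) (by linarith)
    nlinarith
  have hpos : 0 < y * s - x * t := by nlinarith
  rw [div_lt_div_iff₀ ht hs]
  have h1 : -b * (y * s - x * t) < ζ * (y * s - x * t) := mul_lt_mul_of_pos_right hζ hpos
  have h2 : -b * (s - t) ≤ -b * (y * s - x * t) :=
    mul_le_mul_of_nonneg_left (by linarith) (by linarith)
  linarith
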